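/- arXiv:2506.16916 — 4 statements merged into one kernel-verified Lean document; each statement's English description precedes it below -/
import Mathlib

section
/- Let α ∈ (0, 1/2) and let u, v > 0 with u ≠ v. Then (uv)^α · ∫_0^{min(u,v)} x^{-2α} (u-x)^{α-1} (v-x)^{α-1} dx = B(α, 1-2α) · |u-v|^{2α-1}, where B denotes the Beta function. -/
open MeasureTheory Real

/-- The Euler Beta function `B(a,b) = ∫_0^1 t^(a-1) (1-t)^(b-1) dt`. -/
noncomputable def betaFn (a b : ℝ) : ℝ := ∫ t in (0:ℝ)..1, t ^ (a - 1) * (1 - t) ^ (b - 1)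

lemma key_alg (α a b x u v w : ℝ) (ha : 0 < a) (hb : 0 < b) (hx : 0 < x) (hu : 0 < u)
    (hv : 0 < v) (hw : 0 < w) :
    (v * w / (u * b * b)) * ((a * v / (u * b)) ^ (α - 1) * (x * w / (u * b)) ^ (1 - 2*α - 1))
      * w ^ (2*α - 1) = (u * v) ^ α * (x ^ (-(2*α)) * a ^ (α - 1) * b ^ (α - 1)) := by
  rw [← exp_log ha, ← exp_log hb, ← exp_log hx, ← exp_log hu, ← exp_log hv, ← exp_log hw]
  simp only [← exp_add, ← exp_sub, ← exp_mul]
  congr 1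
  ring

lemma image_aux (u v : ℝ) (hu : 0 < u) (huv : u < v) :
    (fun x : ℝ => (u - x) * v / (u * (v - x))) '' Set.Ioo 0 u = Set.Ioo 0 1 := by
  ext t
  constructor
  · rintro ⟨x, ⟨h0, h1⟩, rfl⟩
    have hb : 0 < v - x := by linarith
    have ha : 0 < u - x := by linarith
    have hv : 0 < v := by linarith
    refine ⟨by positivity, ?_⟩
    rw [div_lt_one (by positivity)]
    nlinarith [mul_pos h0 (sub_pos.2 huv)]
  · rintro ⟨h0, h1⟩
    have hv : 0 < v := by linarith
    have hd : 0 < v - u * t := by nlinarith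
    have hd' := hd.ne'
    have h1' : 0 < 1 - t := by linarith
    have hw : 0 < v - u := by linarith
    refine ⟨u * v * (1 - t) / (v - u * t), ⟨by positivity, ?_⟩, ?_⟩
    · rw [div_lt_iff₀ hd]
      nlinarith [mul_pos (mul_pos hu h0) hw]
    · have e1 : u - u * v * (1 - t) / (v - u * t) = u * t * (v - u) / (v - u * t) := by
        field_simp
        ring
      have e2 : v - u * v * (1 - t) / (v - u * t) = v * (v - u) / (v - u * t) := by
        field_simp
        ring
      simp only [e1, e2]
      field_simp

lemma main_lt (α u v : ℝ) (hu : 0 < u) (huv : u < v) :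
    (u * v) ^ α *
      (∫ x in Set.Ioo (0:ℝ) u, x ^ (-(2*α)) * (u - x) ^ (α - 1) * (v - x) ^ (α - 1)) =
      betaFn α (1 - 2*α) * (v - u) ^ (2*α - 1) := by
  have hv : 0 < v := by linarith
  have hw : 0 < v - u := by linarith
  have hder : ∀ x ∈ Set.Ioo (0:ℝ) u, HasDerivWithinAt
      (fun x : ℝ => (u - x) * v / (u * (v - x))) (-(v * (v - u) / (u * (v - x) * (v - x))))
      (Set.Ioo 0 u) x := by
    intro x hx
    have hb : 0 < v - x := by linarith [hx.2]
    have h1 : HasDerivAt (fun x : ℝ => (u - x) * v) (-1 * v) x :=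
      ((hasDerivAt_id x).const_sub u).mul_const v
    have h2 : HasDerivAt (fun x : ℝ => u * (v - x)) (u * -1) x :=
      ((hasDerivAt_id x).const_sub v).const_mul u
    have h3 := h1.div h2 (by positivity)
    refine HasDerivAt.hasDerivWithinAt (h3.congr_deriv ?_)
    field_simp
    ring
  have hinj : Set.InjOn (fun x : ℝ => (u - x) * v / (u * (v - x))) (Set.Ioo 0 u) := by
    intro x hx y hy h
    have hb : 0 < v - x := by linarith [hx.2]
    have hc : 0 < v - y := by linarith [hy.2]
    simp only at h
    rw [div_eq_div_iff (by positivity) (by positivity)] at h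
    have : u * v * (v - u) * (x - y) = 0 := by linarith
    have h0 : u * v * (v - u) ≠ 0 := by positivity
    have := (mul_eq_zero.1 this).resolve_left h0
    linarith
  have hcv := integral_image_eq_integral_abs_deriv_smul measurableSet_Ioo hder hinj
    (fun t => t ^ (α - 1) * (1 - t) ^ (1 - 2*α - 1))
  rw [image_aux u v hu huv] at hcv
  rw [betaFn, intervalIntegral.integral_of_le zero_le_one, integral_Ioc_eq_integral_Ioo, hcv,
    ← integral_const_mul, ← integral_mul_const]
  refine setIntegral_congr_fun measurableSet_Ioo ?_
  intro x hx
  have hb : 0 < v - x := by linarith [hx.2]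
  have ha : 0 < u - x := by linarith [hx.2]
  have e : 1 - (u - x) * v / (u * (v - x)) = x * (v - u) / (u * (v - x)) := by
    field_simp
    ring
  simp only [e, smul_eq_mul, abs_neg]
  rw [abs_of_pos (by positivity)]
  exact (key_alg α _ _ x u v _ ha hb hx.1 hu hv hw).symm

/-- For `α ∈ (0,1/2)` and `u, v > 0` with `u ≠ v`,
`(uv)^α ∫_0^{u∧v} x^{-2α} (u-x)^{α-1} (v-x)^{α-1} dx = B(α, 1-2α) |u-v|^{2α-1}`. -/
theorem stmt_0 (α u v : ℝ) (hα : α ∈ Set.Ioo (0:ℝ) (1/2))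
    (hu : 0 < u) (hv : 0 < v) (huv : u ≠ v) :
    (u * v) ^ α *
      (∫ x in Set.Ioo (0:ℝ) (min u v),
        x ^ (-(2*α)) * (u - x) ^ (α - 1) * (v - x) ^ (α - 1)) =
      betaFn α (1 - 2*α) * |u - v| ^ (2*α - 1) := by
  rcases lt_or_gt_of_ne huv with h | h
  · rw [min_eq_left h.le, abs_sub_comm, abs_of_pos (sub_pos.2 h)]
    exact main_lt α u v hu h
  · rw [min_eq_right h.le, abs_of_pos (sub_pos.2 h), ← main_lt α v u hv h, mul_comm u v]
    simp only [mul_right_comm]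
end

section
/- Let T > 0, H ∈ (1/2, 1), q ∈ ℕ (q ≥ 1), and s, t ∈ [0, T]. Then q! · ∫_{[0,T]^q} L_s^{H,q}(x) · L_t^{H,q}(x) dx = (1/2)(s^{2H} + t^{2H} - |t-s|^{2H}). -/
open MeasureTheory Real

/-- The normalizing constant `c_{H,q}` of the Hermite process of order `q`
and Hurst parameter `H`. -/
noncomputable def cHq (H : ℝ) (q : ℕ) : ℝ :=
  (H * (2 * H - 1) / ((q.factorial : ℝ) *
    betaFn (1/2 - (1 - H)/(q:ℝ)) (2 * (1 - H)/(q:ℝ)) ^ q)) ^ ((1:ℝ)/2)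

/-- The kernel `L_t^{H,q}` of the finite-time-interval representation of the
Hermite process of order `q` and Hurst parameter `H`. -/
noncomputable def LHq (H : ℝ) (q : ℕ) (t : ℝ) : (Fin q → ℝ) → ℝ :=
  Set.indicator (Set.univ.pi fun _ : Fin q => Set.Ioo (0:ℝ) t)
    (fun x => cHq H q * ∫ u in (⨆ i, x i)..t,
      ∏ i, (u / x i) ^ (1/2 - (1 - H)/(q:ℝ)) * (u - x i) ^ (-(1/2 + (1 - H)/(q:ℝ))))

open scoped ENNReal

/-- One-dimensional kernel, extended by zero. -/
noncomputable def kk (a u x : ℝ) : ℝ≥0∞ :=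
  if 0 < x ∧ x < u then ENNReal.ofReal ((u / x) ^ a * (u - x) ^ (a - 1)) else 0

lemma measurable_kk (a : ℝ) : Measurable (fun p : ℝ × ℝ => kk a p.1 p.2) := by
  unfold kk
  refine Measurable.ite ?_ (by fun_prop) measurable_const
  exact (measurableSet_lt measurable_const measurable_snd).inter
    (measurableSet_lt measurable_snd measurable_fst)

lemma lintegral_Ioc_ofReal {f : ℝ → ℝ} {c d : ℝ} (hcd : c ≤ d)
    (hf : IntervalIntegrable f volume c d) (h0 : ∀ x ∈ Set.Ioc c d, 0 ≤ f x) :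
    ∫⁻ x in Set.Ioc c d, ENNReal.ofReal (f x) = ENNReal.ofReal (∫ x in c..d, f x) := by
  rw [intervalIntegral.integral_of_le hcd, ofReal_integral_eq_lintegral_ofReal]
  · exact (intervalIntegrable_iff_integrableOn_Ioc_of_le hcd).1 hf
  · exact (ae_restrict_iff' measurableSet_Ioc).2 (Filter.Eventually.of_forall h0)

lemma lintegral_pi_prod (n : ℕ) (f : ℝ → ℝ≥0∞) (hf : Measurable f) :
    ∫⁻ x : Fin n → ℝ, ∏ i, f (x i) = (∫⁻ x, f x) ^ n := by
  induction n with
  | zero => simp [volume_pi]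
  | succ n ih =>
    rw [← ((volume_preserving_piFinSuccAbove (fun _ : Fin (n+1) => ℝ) 0).symm).lintegral_comp_emb
      (MeasurableEquiv.measurableEmbedding _)]
    simp_rw [MeasurableEquiv.piFinSuccAbove_symm_apply, Fin.insertNthEquiv,
            Fin.prod_univ_succ, Fin.insertNth_zero, Equiv.coe_fn_mk, Fin.cons_succ,
            Fin.cons_zero]
    rw [Measure.volume_eq_prod]
    have := lintegral_prod_mul (μ := (volume : Measure ℝ)) (ν := (volume : Measure (Fin n → ℝ)))
      (f := f) (g := fun x => ∏ i, f (x i)) hf.aemeasurable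
      (Finset.measurable_prod _ (fun i _ => hf.comp (measurable_pi_apply i))).aemeasurable
    rw [pow_succ', ← ih, ← this]
    rfl

lemma betaFn_spec {a b : ℝ} (ha : 0 < a) (hb : 0 < b) :
    0 < betaFn a b ∧
    ∫⁻ x in Set.Ioo (0:ℝ) 1, ENNReal.ofReal (x ^ (a - 1) * (1 - x) ^ (b - 1))
      = ENNReal.ofReal (betaFn a b) := by
  have hB := ProbabilityTheory.beta_pos ha hb
  have h1 := ProbabilityTheory.lintegral_betaPDF_eq_one ha hb
  rw [ProbabilityTheory.lintegral_betaPDF] at h1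
  have h2 : ∫⁻ x in Set.Ioo (0:ℝ) 1, ENNReal.ofReal (x ^ (a - 1) * (1 - x) ^ (b - 1))
      = ENNReal.ofReal (ProbabilityTheory.beta a b) := by
    have h3 : ∀ x : ℝ, ENNReal.ofReal (1 / ProbabilityTheory.beta a b * x ^ (a - 1) * (1 - x) ^ (b - 1))
        = ENNReal.ofReal (1 / ProbabilityTheory.beta a b) *
          ENNReal.ofReal (x ^ (a - 1) * (1 - x) ^ (b - 1)) := by
      intro x
      rw [← ENNReal.ofReal_mul (by positivity), mul_assoc]
    simp_rw [h3] at h1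
    rw [lintegral_const_mul' _ _ ENNReal.ofReal_ne_top] at h1
    have h4 := congrArg (fun y => ENNReal.ofReal (ProbabilityTheory.beta a b) * y) h1
    simp only [← mul_assoc] at h4
    rw [← ENNReal.ofReal_mul hB.le, mul_one_div_cancel hB.ne'] at h4
    simpa using h4
  have h5 : betaFn a b = ProbabilityTheory.beta a b := by
    rw [betaFn, intervalIntegral.integral_of_le zero_le_one, integral_Ioc_eq_integral_Ioo,
      integral_eq_lintegral_of_nonneg_ae, h2, ENNReal.toReal_ofReal hB.le]
    · refine (ae_restrict_iff' measurableSet_Ioo).2 (Filter.Eventually.of_forall ?_)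
      intro x hx
      have := hx.1
      have : 0 < 1 - x := by linarith [hx.2]
      simp only [Pi.zero_apply]
      positivity
    · exact Measurable.aestronglyMeasurable (by fun_prop)
  rw [h5]
  exact ⟨hB, h2⟩

lemma kk_pointwise {a u v x : ℝ} (hx : 0 < x) (hxu : x < u) (huv : u < v) :
    (v * (v - u) / (u * (v - x) ^ 2)) *
      (((u - x) * v / ((v - x) * u)) ^ (a - 1) *
        (x * (v - u) / ((v - x) * u)) ^ (1 - 2 * a - 1)) =
    (v - u) ^ (1 - 2 * a) * ((u / x) ^ a * (u - x) ^ (a - 1) * ((v / x) ^ a * (v - x) ^ (a - 1))) := by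
  have hu : 0 < u := hx.trans hxu
  have hv : 0 < v := hu.trans huv
  have h1 : 0 < v - u := by linarith
  have h2 : 0 < v - x := by linarith
  have h3 : 0 < u - x := by linarith
  generalize v - u = A at *
  generalize v - x = B at *
  generalize u - x = C at *
  apply Real.log_injOn_pos (Set.mem_Ioi.2 (by positivity)) (Set.mem_Ioi.2 (by positivity))
  have e1 : ∀ p : ℝ, C ^ p ≠ 0 := fun p => (Real.rpow_pos_of_pos h3 p).ne'
  have e2 : ∀ p : ℝ, B ^ p ≠ 0 := fun p => (Real.rpow_pos_of_pos h2 p).ne'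
  have e3 : ∀ p : ℝ, A ^ p ≠ 0 := fun p => (Real.rpow_pos_of_pos h1 p).ne'
  rw [Real.log_mul (by positivity) (by positivity), Real.log_mul (by positivity) (by positivity),
    Real.log_mul (by positivity) (by positivity), Real.log_mul (by positivity) (by positivity),
    Real.log_mul (by positivity) (by positivity), Real.log_mul (by positivity) (by positivity),
    Real.log_rpow (by positivity), Real.log_rpow (by positivity), Real.log_rpow (by positivity),
    Real.log_rpow (by positivity), Real.log_rpow (by positivity), Real.log_rpow (by positivity),
    Real.log_rpow (by positivity), Real.log_div (by positivity) (by positivity),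
    Real.log_div (by positivity) (by positivity), Real.log_div (by positivity) (by positivity),
    Real.log_div (by positivity) (by positivity), Real.log_div (by positivity) (by positivity),
    Real.log_mul (by positivity) (by positivity), Real.log_mul (by positivity) (by positivity),
    Real.log_mul (by positivity) (by positivity), Real.log_mul (by positivity) (by positivity),
    Real.log_mul (by positivity) (by positivity), Real.log_pow]
  push_cast
  ring

lemma kk_int {a u v : ℝ} (ha : 0 < a) (ha2 : a < 1/2) (hu : 0 < u) (huv : u < v) :
    ∫⁻ x, kk a u x * kk a v x =
      ENNReal.ofReal (betaFn a (1 - 2 * a) * (v - u) ^ (2 * a - 1)) := by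
  have hv : 0 < v := hu.trans huv
  have hvu : 0 < v - u := by linarith
  obtain ⟨hB, hb⟩ := betaFn_spec ha (show 0 < 1 - 2 * a by linarith)
  have himg : (fun x => (u - x) * v / ((v - x) * u)) '' Set.Ioo 0 u = Set.Ioo 0 1 := by
    ext z
    constructor
    · rintro ⟨x, ⟨hx0, hxu⟩, rfl⟩
      have h2 : 0 < v - x := by linarith
      have h3 : 0 < u - x := by linarith
      refine ⟨by positivity, ?_⟩
      show (u - x) * v / ((v - x) * u) < 1
      rw [div_lt_one (by positivity)]
      nlinarith [mul_pos hx0 hvu]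
    · rintro ⟨hz0, hz1⟩
      have h1 : 0 < 1 - z := by linarith
      have h2 : 0 < v - u * z := by nlinarith
      refine ⟨u * v * (1 - z) / (v - u * z), ⟨by positivity, ?_⟩, ?_⟩
      · rw [div_lt_iff₀ h2]
        nlinarith [mul_pos (mul_pos hu hz0) hvu]
      · have e1 : u - u * v * (1 - z) / (v - u * z) = u * z * (v - u) / (v - u * z) := by
          field_simp; ring
        have e2 : v - u * v * (1 - z) / (v - u * z) = v * (v - u) / (v - u * z) := by
          field_simp; ring
        simp only
        rw [e1, e2]
        field_simp
  have hder : ∀ x ∈ Set.Ioo 0 u, HasDerivWithinAt (fun x => (u - x) * v / ((v - x) * u))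
      (-(v * (v - u) / (u * (v - x) ^ 2))) (Set.Ioo 0 u) x := by
    rintro x ⟨hx0, hxu⟩
    have h2 : 0 < v - x := by linarith
    have d1 : HasDerivAt (fun x => (u - x) * v) (-1 * v) x :=
      ((hasDerivAt_id x).const_sub u).mul_const v
    have d2 : HasDerivAt (fun x => (v - x) * u) (-1 * u) x :=
      ((hasDerivAt_id x).const_sub v).mul_const u
    have := (d1.fun_div d2 (by positivity)).hasDerivWithinAt (s := Set.Ioo 0 u)
    refine this.congr_deriv ?_
    field_simp
    ring
  have hinj : Set.InjOn (fun x => (u - x) * v / ((v - x) * u)) (Set.Ioo 0 u) := by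
    rintro x ⟨hx0, hxu⟩ y ⟨hy0, hyu⟩ h
    have h2 : 0 < v - x := by linarith
    have h3 : 0 < v - y := by linarith
    simp only at h
    rw [div_eq_div_iff (by positivity) (by positivity)] at h
    have : (u * v * (v - u)) * (x - y) = 0 := by linear_combination -h
    rcases mul_eq_zero.1 this with h | h
    · exact absurd h (by positivity)
    · linarith
  have key := lintegral_image_eq_lintegral_abs_deriv_mul measurableSet_Ioo hder hinj
    (fun z => ENNReal.ofReal (z ^ (a - 1) * (1 - z) ^ (1 - 2 * a - 1)))
  rw [himg, hb] at key
  have e : ∫⁻ x in Set.Ioo 0 u, ENNReal.ofReal |(-(v * (v - u) / (u * (v - x) ^ 2)))| *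
      ENNReal.ofReal (((u - x) * v / ((v - x) * u)) ^ (a - 1) *
        (1 - ((u - x) * v / ((v - x) * u))) ^ (1 - 2 * a - 1)) =
      ∫⁻ x in Set.Ioo 0 u, ENNReal.ofReal ((v - u) ^ (1 - 2 * a)) * (kk a u x * kk a v x) := by
    refine setLIntegral_congr_fun measurableSet_Ioo ?_
    rintro x ⟨hx0, hxu⟩
    have h2 : 0 < v - x := by linarith
    have h3 : 0 < u - x := by linarith
    simp only
    have e1 : 1 - ((u - x) * v / ((v - x) * u)) = x * (v - u) / ((v - x) * u) := by
      field_simp; ring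
    rw [e1, abs_neg, abs_of_pos (by positivity), kk, kk, if_pos ⟨hx0, hxu⟩,
      if_pos ⟨hx0, hxu.trans huv⟩, ← ENNReal.ofReal_mul (by positivity),
      ← ENNReal.ofReal_mul (by positivity), ← ENNReal.ofReal_mul (by positivity),
      kk_pointwise hx0 hxu huv]
  rw [e, lintegral_const_mul' _ _ ENNReal.ofReal_ne_top] at key
  have hset : ∫⁻ x in Set.Ioo 0 u, kk a u x * kk a v x = ∫⁻ x, kk a u x * kk a v x := by
    rw [← lintegral_indicator measurableSet_Ioo]
    congr 1
    ext x
    by_cases hx : x ∈ Set.Ioo 0 u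
    · rw [Set.indicator_of_mem hx]
    · rw [Set.indicator_of_notMem hx, kk, if_neg (by simpa using hx), zero_mul]
  rw [hset] at key
  rw [mul_comm, ENNReal.ofReal_mul (by positivity), key, ← mul_assoc,
    ← ENNReal.ofReal_mul (by positivity), ← Real.rpow_add hvu]
  simp

lemma kk_int' {a u v : ℝ} (ha : 0 < a) (ha2 : a < 1/2) (hu : 0 < u) (hv : 0 < v) (huv : v ≠ u) :
    ∫⁻ x, kk a u x * kk a v x =
      ENNReal.ofReal (betaFn a (1 - 2 * a) * |v - u| ^ (2 * a - 1)) := by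
  rcases lt_or_gt_of_ne huv with h | h
  · simp_rw [mul_comm (kk a u _)]
    rw [kk_int ha ha2 hv h, abs_sub_comm, abs_of_pos (by linarith)]
  · rw [kk_int ha ha2 hu h, abs_of_pos (by linarith)]

lemma inner_int {p t u : ℝ} (hp : -1 < p) (hu : 0 < u) (hut : u < t) :
    ∫⁻ v in Set.Ioo 0 t, ENNReal.ofReal (|v - u| ^ p) =
      ENNReal.ofReal ((u ^ (p+1) + (t - u) ^ (p+1)) / (p + 1)) := by
  have hp1 : 0 < p + 1 := by linarith
  rw [setLIntegral_congr Ioo_ae_eq_Ioc, ← Set.Ioc_union_Ioc_eq_Ioc hu.le hut.le,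
    lintegral_union measurableSet_Ioc (Set.Ioc_disjoint_Ioc_of_le le_rfl)]
  have h1 : ∫⁻ v in Set.Ioc 0 u, ENNReal.ofReal (|v - u| ^ p) = ENNReal.ofReal (u ^ (p+1) / (p+1)) := by
    rw [setLIntegral_congr_fun (g := fun v => ENNReal.ofReal ((u - v) ^ p)) measurableSet_Ioc,
      lintegral_Ioc_ofReal hu.le]
    · rw [intervalIntegral.integral_comp_sub_left (fun x => x ^ p), integral_rpow (Or.inl hp)]
      simp [Real.zero_rpow hp1.ne']
    · have := (intervalIntegral.intervalIntegrable_rpow' (a := u) (b := 0) hp).comp_sub_left u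
      simpa using this
    · intro x hx
      exact Real.rpow_nonneg (by linarith [hx.2]) _
    · intro x hx
      simp only
      rw [abs_sub_comm, abs_of_nonneg (by linarith [hx.2])]
  have h2 : ∫⁻ v in Set.Ioc u t, ENNReal.ofReal (|v - u| ^ p) = ENNReal.ofReal ((t - u) ^ (p+1) / (p+1)) := by
    rw [setLIntegral_congr_fun (g := fun v => ENNReal.ofReal ((v - u) ^ p)) measurableSet_Ioc,
      lintegral_Ioc_ofReal hut.le]
    · rw [intervalIntegral.integral_comp_sub_right (fun x => x ^ p), integral_rpow (Or.inl hp)]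
      simp [Real.zero_rpow hp1.ne']
    · have := (intervalIntegral.intervalIntegrable_rpow' (a := 0) (b := t - u) hp).comp_sub_right u
      simpa using this
    · intro x hx
      exact Real.rpow_nonneg (by linarith [hx.1]) _
    · intro x hx
      simp only
      rw [abs_of_nonneg (by linarith [hx.1])]
  have h3 : 0 < t - u := by linarith
  rw [h1, h2, ← ENNReal.ofReal_add (by positivity) (by positivity), add_div]

lemma double_int {H s t : ℝ} (hH : H ∈ Set.Ioo (1/2:ℝ) 1) (hs : 0 ≤ s) (hst : s ≤ t) :
    ∫⁻ u in Set.Ioo 0 s, ∫⁻ v in Set.Ioo 0 t, ENNReal.ofReal (|v - u| ^ (2*H-2)) =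
      ENNReal.ofReal ((s ^ (2*H) + t ^ (2*H) - (t - s) ^ (2*H)) / (2 * H * (2*H-1))) := by
  obtain ⟨hH1, hH2⟩ := hH
  have hp : 0 < 2 * H - 1 := by linarith
  rw [setLIntegral_congr_fun (g := fun u => ENNReal.ofReal ((u ^ (2*H-1) + (t - u) ^ (2*H-1)) / (2*H-1)))
    measurableSet_Ioo, setLIntegral_congr Ioo_ae_eq_Ioc, lintegral_Ioc_ofReal hs]
  · have i1 : IntervalIntegrable (fun u : ℝ => u ^ (2*H-1)) volume 0 s :=
      intervalIntegral.intervalIntegrable_rpow' (by linarith)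
    have i2 : IntervalIntegrable (fun u : ℝ => (t - u) ^ (2*H-1)) volume 0 s := by
      have := (intervalIntegral.intervalIntegrable_rpow' (a := t) (b := t - s) (r := 2*H-1)
        (by linarith)).comp_sub_left t
      simpa using this
    rw [intervalIntegral.integral_div, intervalIntegral.integral_add i1 i2,
      intervalIntegral.integral_comp_sub_left (fun x => x ^ (2*H-1)),
      integral_rpow (Or.inl (by linarith)), integral_rpow (Or.inl (by linarith))]
    have e : 2 * H - 1 + 1 = 2 * H := by ring
    rw [e, Real.zero_rpow (by linarith), sub_zero, sub_zero]
    congr 1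
    field_simp
    ring
  · have i1 : IntervalIntegrable (fun u : ℝ => u ^ (2*H-1)) volume 0 s :=
      intervalIntegral.intervalIntegrable_rpow' (by linarith)
    have i2 : IntervalIntegrable (fun u : ℝ => (t - u) ^ (2*H-1)) volume 0 s := by
      have := (intervalIntegral.intervalIntegrable_rpow' (a := t) (b := t - s) (r := 2*H-1)
        (by linarith)).comp_sub_left t
      simpa using this
    exact (i1.add i2).div_const _
  · intro x hx
    have := hx.1
    have : 0 ≤ t - x := by linarith [hx.2]
    positivity
  · intro u hu
    simp only
    rw [inner_int (by linarith) hu.1 (hu.2.trans_le hst)]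
    have e : 2 * H - 2 + 1 = 2 * H - 1 := by ring
    rw [e]

/-- The product kernel integrated in time, as an extended nonnegative function. -/
noncomputable def FF (a : ℝ) (q : ℕ) (t : ℝ) (x : Fin q → ℝ) : ℝ≥0∞ :=
  ∫⁻ u in Set.Ioo 0 t, ∏ i, kk a u (x i)

lemma measurable_prod_kk (a : ℝ) (q : ℕ) :
    Measurable (fun p : ℝ × (Fin q → ℝ) => ∏ i, kk a p.1 (p.2 i)) := by
  refine Finset.measurable_prod _ (fun i _ => ?_)
  exact (measurable_kk a).comp
    (measurable_fst.prodMk ((measurable_pi_apply i).comp measurable_snd))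

lemma measurable_FF (a : ℝ) (q : ℕ) (t : ℝ) : Measurable (FF a q t) := by
  unfold FF
  exact (measurable_prod_kk a q).lintegral_prod_left'

lemma FF_eq_zero {a : ℝ} {q : ℕ} {t : ℝ} {x : Fin q → ℝ}
    (hx : x ∉ Set.univ.pi fun _ : Fin q => Set.Ioo (0:ℝ) t) : FF a q t x = 0 := by
  simp only [Set.mem_pi, Set.mem_univ, true_imp_iff, not_forall] at hx
  obtain ⟨i, hi⟩ := hx
  unfold FF
  rw [setLIntegral_congr_fun (g := fun _ => 0) measurableSet_Ioo]
  · simp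
  · intro u hu
    refine Finset.prod_eq_zero (Finset.mem_univ i) ?_
    rw [kk, if_neg]
    rintro ⟨h1, h2⟩
    exact hi ⟨h1, h2.trans hu.2⟩

lemma LHq_eq {H : ℝ} {q : ℕ} (hq : 1 ≤ q) (t : ℝ) (x : Fin q → ℝ) :
    LHq H q t x = cHq H q * (FF (1/2 - (1 - H)/(q:ℝ)) q t x).toReal := by
  unfold LHq
  by_cases hx : x ∈ Set.univ.pi fun _ : Fin q => Set.Ioo (0:ℝ) t
  swap
  · rw [Set.indicator_of_notMem hx, FF_eq_zero hx]; simp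
  rw [Set.indicator_of_mem hx]
  congr 1
  simp only [Set.mem_pi, Set.mem_univ, true_imp_iff] at hx
  have : Nonempty (Fin q) := ⟨⟨0, hq⟩⟩
  obtain ⟨j, hj⟩ := exists_eq_ciSup_of_finite (f := x)
  have hle : ∀ i, x i ≤ x j := fun i => hj ▸ le_ciSup (Set.finite_range x).bddAbove i
  rw [← hj]
  set a := 1/2 - (1 - H)/(q:ℝ) with ha
  have hb : -(1/2 + (1 - H)/(q:ℝ)) = a - 1 := by rw [ha]; ring
  rw [hb, intervalIntegral.integral_of_le (hx j).2.le, integral_Ioc_eq_integral_Ioo,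
    integral_eq_lintegral_of_nonneg_ae]
  · congr 1
    unfold FF
    have hsub : Set.Ioo (x j) t ⊆ Set.Ioo 0 t := Set.Ioo_subset_Ioo_left (hx j).1.le
    rw [← lintegral_indicator measurableSet_Ioo, ← lintegral_indicator measurableSet_Ioo]
    congr 1
    ext u
    by_cases hu : u ∈ Set.Ioo (x j) t
    · rw [Set.indicator_of_mem hu, Set.indicator_of_mem (hsub hu), ENNReal.ofReal_prod_of_nonneg]
      · refine Finset.prod_congr rfl (fun i _ => ?_)
        rw [kk, if_pos ⟨(hx i).1, (hle i).trans_lt hu.1⟩]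
      · intro i _
        have h1 := (hx i).1
        have h2 : 0 < u - x i := by linarith [hle i, hu.1]
        have h3 : 0 < u := by linarith
        positivity
    · rw [Set.indicator_of_notMem hu]
      by_cases hu' : u ∈ Set.Ioo 0 t
      · rw [Set.indicator_of_mem hu', eq_comm]
        refine Finset.prod_eq_zero (Finset.mem_univ j) ?_
        rw [kk, if_neg]
        rintro ⟨h1, h2⟩
        exact hu ⟨h2, hu'.2⟩
      · rw [Set.indicator_of_notMem hu']
  · refine (ae_restrict_iff' measurableSet_Ioo).2 (Filter.Eventually.of_forall ?_)
    intro u hu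
    refine Finset.prod_nonneg (fun i _ => ?_)
    have h1 := (hx i).1
    have h2 : 0 < u - x i := by linarith [hle i, hu.1]
    have h3 : 0 < u := by linarith
    positivity
  · exact Measurable.aestronglyMeasurable (by fun_prop)

lemma FF_int {H : ℝ} (hH : H ∈ Set.Ioo (1/2:ℝ) 1) {q : ℕ} (hq : 1 ≤ q) {s t : ℝ}
    (hs : 0 ≤ s) (hst : s ≤ t) :
    ∫⁻ x, FF (1/2 - (1 - H)/(q:ℝ)) q s x * FF (1/2 - (1 - H)/(q:ℝ)) q t x =
      ENNReal.ofReal (betaFn (1/2 - (1 - H)/(q:ℝ)) (2 * (1 - H)/(q:ℝ)) ^ q *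
      ((s ^ (2*H) + t ^ (2*H) - (t - s) ^ (2*H)) / (2 * H * (2*H-1)))) := by
  obtain ⟨hH1, hH2⟩ := id hH
  have hq' : (1:ℝ) ≤ q := by exact_mod_cast hq
  have hq0 : (0:ℝ) < q := by linarith
  set a := 1/2 - (1 - H)/(q:ℝ) with ha
  have hr : 0 < (1 - H)/(q:ℝ) := div_pos (by linarith) hq0
  have hr2 : (1 - H)/(q:ℝ) < 1/2 := by rw [div_lt_iff₀ hq0]; nlinarith
  have ha0 : 0 < a := by linarith
  have ha2 : a < 1/2 := by linarith
  have hb : 2 * (1 - H)/(q:ℝ) = 1 - 2 * a := by rw [ha]; ring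
  rw [hb]
  have hB := (betaFn_spec ha0 (show 0 < 1 - 2 * a by linarith)).1
  have hexp : (2 * a - 1) * q = 2 * H - 2 := by rw [ha]; field_simp; ring
  have hm := measurable_prod_kk a q
  have hm1 : ∀ x : Fin q → ℝ, Measurable (fun u => ∏ i, kk a u (x i)) := fun x =>
    hm.comp (measurable_id.prodMk measurable_const)
  have hmk : ∀ u, Measurable (kk a u) := fun u =>
    (measurable_kk a).comp (measurable_const.prodMk measurable_id)
  have e1 : ∀ x : Fin q → ℝ, FF a q s x * FF a q t x =
      ∫⁻ p, (∏ i, kk a p.1 (x i)) * (∏ i, kk a p.2 (x i))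
        ∂((volume.restrict (Set.Ioo 0 s)).prod (volume.restrict (Set.Ioo 0 t))) := by
    intro x
    rw [lintegral_prod_mul (hm1 x).aemeasurable (hm1 x).aemeasurable]
    rfl
  have hmG : Measurable (fun y : (Fin q → ℝ) × (ℝ × ℝ) =>
      (∏ i, kk a y.2.1 (y.1 i)) * (∏ i, kk a y.2.2 (y.1 i))) :=
    (hm.comp ((measurable_fst.comp measurable_snd).prodMk measurable_fst)).mul
      (hm.comp ((measurable_snd.comp measurable_snd).prodMk measurable_fst))
  simp_rw [e1]
  rw [lintegral_lintegral_swap hmG.aemeasurable]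
  have e2 : ∀ p : ℝ × ℝ, ∫⁻ x : Fin q → ℝ, (∏ i, kk a p.1 (x i)) * (∏ i, kk a p.2 (x i)) =
      (∫⁻ x, kk a p.1 x * kk a p.2 x) ^ q := by
    intro p
    rw [← lintegral_pi_prod q (fun x => kk a p.1 x * kk a p.2 x) ((hmk p.1).mul (hmk p.2))]
    simp_rw [Finset.prod_mul_distrib]
  simp_rw [e2]
  have hmP : Measurable (fun p : ℝ × ℝ => (∫⁻ x, kk a p.1 x * kk a p.2 x) ^ q) := by
    refine Measurable.pow_const ?_ q
    refine Measurable.lintegral_prod_right' (f := fun y : (ℝ × ℝ) × ℝ => kk a y.1.1 y.2 * kk a y.1.2 y.2) ?_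
    exact ((measurable_kk a).comp ((measurable_fst.comp measurable_fst).prodMk measurable_snd)).mul
      ((measurable_kk a).comp ((measurable_snd.comp measurable_fst).prodMk measurable_snd))
  rw [lintegral_prod _ hmP.aemeasurable]
  rw [ENNReal.ofReal_mul (by positivity), ← double_int hH hs hst,
    ← lintegral_const_mul' _ _ ENNReal.ofReal_ne_top]
  refine setLIntegral_congr_fun measurableSet_Ioo ?_
  intro u hu
  simp only
  rw [← lintegral_const_mul' _ _ ENNReal.ofReal_ne_top]
  refine lintegral_congr_ae ?_
  have hne : ∀ᵐ v ∂(volume.restrict (Set.Ioo 0 t)), v ≠ u :=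
    ae_restrict_of_ae (Measure.ae_ne volume u)
  filter_upwards [hne, ae_restrict_mem measurableSet_Ioo] with v hv hv2
  have habs : 0 < |v - u| := abs_pos.2 (sub_ne_zero.2 hv)
  rw [kk_int' ha0 ha2 hu.1 hv2.1 hv, ← ENNReal.ofReal_pow (by positivity),
    ← ENNReal.ofReal_mul (by positivity), mul_pow, ← Real.rpow_mul_natCast habs.le, hexp]

lemma stmt_aux (T H : ℝ) (hH : H ∈ Set.Ioo (1/2:ℝ) 1)
    (q : ℕ) (hq : 1 ≤ q) (s t : ℝ) (hs : s ∈ Set.Icc (0:ℝ) T) (ht : t ∈ Set.Icc (0:ℝ) T)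
    (hst : s ≤ t) :
    (q.factorial : ℝ) *
      (∫ x in Set.univ.pi fun _ : Fin q => Set.Icc (0:ℝ) T, LHq H q s x * LHq H q t x) =
      (1/2) * (s ^ (2*H) + t ^ (2*H) - |t - s| ^ (2*H)) := by
  obtain ⟨hH1, hH2⟩ := id hH
  have hq' : (1:ℝ) ≤ q := by exact_mod_cast hq
  have hq0 : (0:ℝ) < q := by linarith
  have hr : 0 < (1 - H)/(q:ℝ) := div_pos (by linarith) hq0
  have hr2 : (1 - H)/(q:ℝ) < 1/2 := by rw [div_lt_iff₀ hq0]; nlinarith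
  have hB := (betaFn_spec (a := 1/2 - (1 - H)/(q:ℝ)) (b := 2 * (1 - H)/(q:ℝ)) (by linarith)
    (by rw [mul_div_assoc]; linarith)).1
  have hI := FF_int hH hq hs.1 hst
  rw [setIntegral_eq_integral_of_forall_compl_eq_zero]
  swap
  · intro x hx
    have : x ∉ Set.univ.pi fun _ : Fin q => Set.Ioo (0:ℝ) s := by
      intro h
      apply hx
      intro i hi
      exact ⟨(h i hi).1.le, (h i hi).2.le.trans hs.2⟩
    rw [LHq_eq hq, FF_eq_zero this]
    simp
  have e : ∀ x, LHq H q s x * LHq H q t x = (cHq H q) ^ 2 *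
      (FF (1/2 - (1 - H)/(q:ℝ)) q s x * FF (1/2 - (1 - H)/(q:ℝ)) q t x).toReal := by
    intro x
    rw [LHq_eq hq, LHq_eq hq, ENNReal.toReal_mul]
    ring
  simp_rw [e]
  have hmF : Measurable (fun x => FF (1/2 - (1 - H)/(q:ℝ)) q s x * FF (1/2 - (1 - H)/(q:ℝ)) q t x) :=
    (measurable_FF (1/2 - (1 - H)/(q:ℝ)) q s).mul (measurable_FF (1/2 - (1 - H)/(q:ℝ)) q t)
  rw [integral_const_mul, integral_toReal hmF.aemeasurable
    (ae_lt_top hmF (by rw [hI]; exact ENNReal.ofReal_ne_top)), hI, ENNReal.toReal_ofReal]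
  · have hc : cHq H q ^ 2 = H * (2 * H - 1) / ((q.factorial : ℝ) *
        betaFn (1/2 - (1 - H)/(q:ℝ)) (2 * (1 - H)/(q:ℝ)) ^ q) := by
      unfold cHq
      have h21 : 0 < 2 * H - 1 := by linarith
      rw [← Real.rpow_mul_natCast (by positivity)]
      norm_num
    have h21 : 2 * H - 1 ≠ 0 := by linarith
    have hH0 : H ≠ 0 := by linarith
    have hf : (q.factorial : ℝ) ≠ 0 := by positivity
    rw [hc, abs_of_nonneg (by linarith)]
    generalize betaFn (1/2 - (1 - H)/(q:ℝ)) (2 * (1 - H)/(q:ℝ)) = B at *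
    have hBq : B ^ q ≠ 0 := by positivity
    field_simp
    rw [mul_comm 2 H] at h21
    field_simp
  · have h21 : 0 < 2 * H - 1 := by linarith
    have h1 : (t - s) ^ (2*H) ≤ t ^ (2*H) :=
      Real.rpow_le_rpow (by linarith) (by linarith [hs.1]) (by linarith)
    have h2 : 0 ≤ s ^ (2*H) := Real.rpow_nonneg hs.1 _
    have h3 : 0 ≤ s ^ (2*H) + t ^ (2*H) - (t - s) ^ (2*H) := by linarith
    positivity

/-- For `T > 0`, `H ∈ (1/2,1)`, `q ≥ 1` and `s, t ∈ [0,T]`,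
`q! ∫_{[0,T]^q} L_s^{H,q}(x) L_t^{H,q}(x) dx = (1/2)(s^{2H} + t^{2H} - |t-s|^{2H})`. -/
theorem stmt_3 (T H : ℝ) (hT : 0 < T) (hH : H ∈ Set.Ioo (1/2:ℝ) 1)
    (q : ℕ) (hq : 1 ≤ q) (s t : ℝ) (hs : s ∈ Set.Icc (0:ℝ) T) (ht : t ∈ Set.Icc (0:ℝ) T) :
    (q.factorial : ℝ) *
      (∫ x in Set.univ.pi fun _ : Fin q => Set.Icc (0:ℝ) T, LHq H q s x * LHq H q t x) =
      (1/2) * (s ^ (2*H) + t ^ (2*H) - |t - s| ^ (2*H)) := by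
  rcases le_total s t with h | h
  · exact stmt_aux T H hH q hq s t hs ht h
  · have := stmt_aux T H hH q hq t s ht hs h
    rw [abs_sub_comm t s, add_comm (s ^ (2*H)), ← this]
    simp_rw [mul_comm]
end

section
/- Let T > 0, H ∈ (1/2, 1), q ∈ ℕ (q ≥ 1), and let f, g : [0,T] → ℝ be bounded measurable functions. Then q! · ∫_{[0,T]^q} (L^{H,q}f)(x) · (L^{H,q}g)(x) dx = H(2H-1) · ∫_0^T ∫_0^T f(u) g(v) |u-v|^{2H-2} du dv. -/
open MeasureTheory Real

/-- The operator `L^{H,q}` applied to a function `f : [0,T] → ℝ`: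
`(L^{H,q}f)(x) = c_{H,q} ∫_{x_1∨…∨x_q}^T f(u) ∏_i (u/x_i)^{1/2-(1-H)/q} (u-x_i)_+^{-(1/2+(1-H)/q)} du`. -/
noncomputable def LHqOp (T H : ℝ) (q : ℕ) (f : ℝ → ℝ) (x : Fin q → ℝ) : ℝ :=
  cHq H q * ∫ u in (⨆ i, x i)..T,
    f u * ∏ i, (u / x i) ^ (1/2 - (1 - H)/(q:ℝ)) *
      (max (u - x i) 0) ^ (-(1/2 + (1 - H)/(q:ℝ)))


noncomputable def phiK (a u x : ℝ) : ℝ := (u / x) ^ a * (max (u - x) 0) ^ (a - 1)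

lemma phiK_zero {a u x : ℝ} (ha : a < 1/2) (h : u ≤ x) : phiK a u x = 0 := by
  unfold phiK
  rw [max_eq_right (by linarith), Real.zero_rpow (by linarith), mul_zero]

lemma phiK_nonneg {a u x : ℝ} (hu : 0 ≤ u) (hx : 0 ≤ x) : 0 ≤ phiK a u x := by
  unfold phiK
  have := div_nonneg hu hx
  positivity

lemma beta_intOn {a b : ℝ} (ha : 0 < a) (hb : 0 < b) :
    IntervalIntegrable (fun t : ℝ => t ^ (a - 1) * (1 - t) ^ (b - 1)) volume 0 1 := by
  have h := Complex.betaIntegral_convergent (u := a) (v := b) (by simpa) (by simpa)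
  rw [intervalIntegrable_iff_integrableOn_Ioc_of_le (by simp)] at h ⊢
  refine IntegrableOn.congr_fun (f := fun x : ℝ => ((x : ℂ) ^ ((a:ℂ) - 1) * (1 - (x : ℂ)) ^ ((b:ℂ) - 1)).re)
    h.re ?_ measurableSet_Ioc
  intro x hx
  have h1 : ((x : ℂ) ^ ((a:ℂ) - 1)) = ((x ^ (a - 1) : ℝ) : ℂ) := by
    rw [Complex.ofReal_cpow hx.1.le]; push_cast; rfl
  have h2 : ((1 - (x : ℂ)) ^ ((b:ℂ) - 1)) = (((1 - x) ^ (b - 1) : ℝ) : ℂ) := by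
    rw [Complex.ofReal_cpow (by linarith [hx.2])]; push_cast; rfl
  simp only [h1, h2]
  rw [← Complex.ofReal_mul, Complex.ofReal_re]

lemma betaFn_pos {a b : ℝ} (ha : 0 < a) (hb : 0 < b) : 0 < betaFn a b := by
  unfold betaFn
  refine intervalIntegral.intervalIntegral_pos_of_pos_on (beta_intOn ha hb) ?_ one_pos
  intro x hx
  have h1 := hx.1
  have h2 : 0 < 1 - x := by linarith [hx.2]
  positivity

lemma phi_pointwise {a u v t : ℝ} (hu : 0 < u) (huv : u < v) (ht0 : 0 < t) (ht1 : t < 1) :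
    |-(u * v * (v - u)) / (v - t * u) ^ 2| *
      (phiK a u (u * v * (1 - t) / (v - t * u)) * phiK a v (u * v * (1 - t) / (v - t * u)))
    = (v - u) ^ (2 * a - 1) * (t ^ (a - 1) * (1 - t) ^ ((1 - 2 * a) - 1)) := by
  have hv : 0 < v := hu.trans huv
  have hD : 0 < v - t * u := by nlinarith
  have hd : 0 < v - u := by linarith
  have h1t : 0 < 1 - t := by linarith
  have e1 : u / (u * v * (1 - t) / (v - t * u)) = (v - t * u) / (v * (1 - t)) := by
    field_simp
  have e2 : v / (u * v * (1 - t) / (v - t * u)) = (v - t * u) / (u * (1 - t)) := by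
    field_simp
  have e3 : max (u - u * v * (1 - t) / (v - t * u)) 0 = u * t * (v - u) / (v - t * u) := by
    have : u - u * v * (1 - t) / (v - t * u) = u * t * (v - u) / (v - t * u) := by
      rw [eq_div_iff hD.ne', sub_mul, div_mul_cancel₀ _ hD.ne']; ring
    rw [this, max_eq_left (by positivity)]
  have e4 : max (v - u * v * (1 - t) / (v - t * u)) 0 = v * (v - u) / (v - t * u) := by
    have : v - u * v * (1 - t) / (v - t * u) = v * (v - u) / (v - t * u) := by
      rw [eq_div_iff hD.ne', sub_mul, div_mul_cancel₀ _ hD.ne']; ring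
    rw [this, max_eq_left (by positivity)]
  have e5 : |-(u * v * (v - u)) / (v - t * u) ^ 2| = u * v * (v - u) / (v - t * u) ^ 2 := by
    rw [neg_div, abs_neg, abs_of_pos (by positivity)]
  unfold phiK
  rw [e1, e2, e3, e4, e5]
  generalize v - t * u = D at *
  generalize v - u = d at *
  generalize 1 - t = s at *
  apply Real.log_injOn_pos
  · simp only [Set.mem_Ioi]; positivity
  · simp only [Set.mem_Ioi]; positivity
  have l1 : Real.log (u * v * d / D ^ 2) = log u + log v + log d - 2 * log D := by
    rw [Real.log_div (by positivity) (by positivity), Real.log_mul (by positivity) (by positivity),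
      Real.log_mul (by positivity) (by positivity), Real.log_pow]; norm_num
  have l2 : Real.log (D / (v * s)) = log D - (log v + log s) := by
    rw [Real.log_div (by positivity) (by positivity), Real.log_mul (by positivity) (by positivity)]
  have l3 : Real.log (D / (u * s)) = log D - (log u + log s) := by
    rw [Real.log_div (by positivity) (by positivity), Real.log_mul (by positivity) (by positivity)]
  have l4 : Real.log (u * t * d / D) = log u + log t + log d - log D := by
    rw [Real.log_div (by positivity) (by positivity), Real.log_mul (by positivity) (by positivity),
      Real.log_mul (by positivity) (by positivity)]
  have l5 : Real.log (v * d / D) = log v + log d - log D := by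
    rw [Real.log_div (by positivity) (by positivity), Real.log_mul (by positivity) (by positivity)]
  rw [Real.log_mul (by positivity) (by positivity), Real.log_mul (by positivity) (by positivity),
    Real.log_mul (by positivity) (by positivity), Real.log_mul (by positivity) (by positivity),
    Real.log_mul (by positivity) (by positivity), Real.log_mul (by positivity) (by positivity),
    Real.log_rpow (by positivity), Real.log_rpow (by positivity), Real.log_rpow (by positivity),
    Real.log_rpow (by positivity), Real.log_rpow (by positivity), Real.log_rpow (by positivity),
    Real.log_rpow (by positivity), l1, l2, l3, l4, l5]
  ring

lemma phi_int_lt {T a u v : ℝ} (ha : 0 < a) (ha' : a < 1/2) (hu : 0 < u) (huv : u < v) (hvT : v < T) :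
    IntegrableOn (fun x => phiK a u x * phiK a v x) (Set.Icc 0 T) ∧
    ∫ x in Set.Icc 0 T, phiK a u x * phiK a v x = betaFn a (1 - 2 * a) * |u - v| ^ (2 * a - 1) := by
  have hv : 0 < v := hu.trans huv
  set ψ : ℝ → ℝ := fun t => u * v * (1 - t) / (v - t * u) with hψ
  set ψ' : ℝ → ℝ := fun t => -(u * v * (v - u)) / (v - t * u) ^ 2 with hψ'
  have hDpos : ∀ t ∈ Set.Ioo (0:ℝ) 1, 0 < v - t * u := fun t ht => by nlinarith [ht.1, ht.2]
  have hder : ∀ t ∈ Set.Ioo (0:ℝ) 1, HasDerivWithinAt ψ (ψ' t) (Set.Ioo 0 1) t := by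
    intro t ht
    have hD := (hDpos t ht).ne'
    have h1 : HasDerivAt (fun t : ℝ => u * v * (1 - t)) (u * v * (-1)) t :=
      ((hasDerivAt_id t).const_sub 1).const_mul _
    have h2 : HasDerivAt (fun t : ℝ => v - t * u) (-(1 * u)) t :=
      ((hasDerivAt_id t).mul_const u).const_sub v
    have h3 := h1.div h2 hD
    refine (h3.congr_deriv ?_).hasDerivWithinAt
    simp only [hψ']
    congr 1; ring
  have hinj : Set.InjOn ψ (Set.Ioo 0 1) := by
    intro s hs t ht hst
    have h1 := (hDpos t ht).ne'
    have h2 := (hDpos s hs).ne'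
    simp only [hψ] at hst
    rw [div_eq_div_iff h2 h1] at hst
    have : u * v * (v - u) * (t - s) = 0 := by linear_combination hst
    have h3 : u * v * (v - u) ≠ 0 := by
      have : 0 < v - u := by linarith
      positivity
    have := (mul_eq_zero.1 this).resolve_left h3
    linarith
  have himg : ψ '' Set.Ioo 0 1 = Set.Ioo 0 u := by
    ext x
    constructor
    · rintro ⟨t, ht, rfl⟩
      have h1 := hDpos t ht
      have h2 : 0 < 1 - t := by linarith [ht.2]
      refine ⟨by simp only [hψ]; positivity, ?_⟩
      simp only [hψ]
      rw [div_lt_iff₀ h1]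
      have : 0 < u * t * (v - u) := by
        have : 0 < v - u := by linarith
        have := ht.1
        positivity
      nlinarith
    · rintro ⟨hx0, hxu⟩
      have hvx : 0 < v - x := by linarith
      have hux : 0 < u - x := by linarith
      have hvu : 0 < v - u := by linarith
      refine ⟨(u - x) * v / (u * (v - x)), ⟨by positivity, ?_⟩, ?_⟩
      · rw [div_lt_one (by positivity)]; nlinarith
      · simp only [hψ]
        have h1 : 1 - (u - x) * v / (u * (v - x)) = x * (v - u) / (u * (v - x)) := by
          field_simp; ring
        have h2 : v - (u - x) * v / (u * (v - x)) * u = v * (v - u) / (v - x) := by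
          field_simp; ring
        rw [h1, h2]; field_simp
  have hpt : ∀ t ∈ Set.Ioo (0:ℝ) 1, |ψ' t| • (phiK a u (ψ t) * phiK a v (ψ t))
      = (v - u) ^ (2 * a - 1) * (t ^ (a - 1) * (1 - t) ^ ((1 - 2 * a) - 1)) := by
    intro t ht
    exact phi_pointwise hu huv ht.1 ht.2
  have hB := beta_intOn (a := a) (b := 1 - 2 * a) ha (by linarith)
  rw [intervalIntegrable_iff_integrableOn_Ioo_of_le (by simp)] at hB
  have hI : IntegrableOn (fun x => phiK a u x * phiK a v x) (Set.Ioo 0 u) := by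
    rw [← himg, integrableOn_image_iff_integrableOn_abs_deriv_smul measurableSet_Ioo hder hinj]
    exact (IntegrableOn.congr_fun (hB.const_mul ((v - u) ^ (2 * a - 1)))
      (fun t ht => (hpt t ht).symm) measurableSet_Ioo)
  have hE : ∫ x in Set.Ioo 0 u, phiK a u x * phiK a v x
      = betaFn a (1 - 2 * a) * |u - v| ^ (2 * a - 1) := by
    rw [← himg, integral_image_eq_integral_abs_deriv_smul measurableSet_Ioo hder hinj,
      setIntegral_congr_fun measurableSet_Ioo hpt, integral_const_mul, abs_sub_comm,
      abs_of_pos (by linarith : 0 < v - u), mul_comm, betaFn,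
      intervalIntegral.integral_of_le zero_le_one, integral_Ioc_eq_integral_Ioo]
  have hsub : Set.Ioo 0 u ⊆ Set.Ioc 0 T := fun x hx => ⟨hx.1, by linarith [hx.2]⟩
  have hz : ∀ x ∈ Set.Ioc 0 T \ Set.Ioo 0 u, phiK a u x * phiK a v x = 0 := by
    intro x hx
    have : u ≤ x := by
      by_contra h
      exact hx.2 ⟨hx.1.1, not_le.1 h⟩
    rw [phiK_zero ha' this, zero_mul]
  constructor
  · rw [integrableOn_Icc_iff_integrableOn_Ioc]
    exact hI.of_forall_sdiff_eq_zero measurableSet_Ioc hz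
  · rw [integral_Icc_eq_integral_Ioc, ← hE]
    exact setIntegral_eq_of_subset_of_forall_sdiff_eq_zero measurableSet_Ioc hsub hz

lemma phi_int {T a u v : ℝ} (ha : 0 < a) (ha' : a < 1/2) (hu : u ∈ Set.Ioo 0 T)
    (hv : v ∈ Set.Ioo 0 T) (huv : u ≠ v) :
    IntegrableOn (fun x => phiK a u x * phiK a v x) (Set.Icc 0 T) ∧
    ∫ x in Set.Icc 0 T, phiK a u x * phiK a v x = betaFn a (1 - 2 * a) * |u - v| ^ (2 * a - 1) := by
  rcases lt_or_gt_of_ne huv with h | h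
  · exact phi_int_lt ha ha' hu.1 h hv.2
  · have := phi_int_lt ha ha' hv.1 h hu.2
    rw [abs_sub_comm v u] at this
    simpa only [mul_comm (phiK a v _)] using this

lemma abs_rpow_int {T p : ℝ} (hT : 0 < T) (hp : -1 < p) :
    Integrable (fun z : ℝ × ℝ => |z.1 - z.2| ^ p)
      ((volume.restrict (Set.Ioo 0 T)).prod (volume.restrict (Set.Ioo 0 T))) := by
  have h0 : IntegrableOn (fun w : ℝ => |w| ^ p) (Set.Ioo (-T) T) := by
    have h1 : IntervalIntegrable (fun w : ℝ => |w| ^ p) volume 0 T := by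
      refine (intervalIntegral.intervalIntegrable_rpow' (a := 0) (b := T) hp).congr ?_
      intro x hx
      rw [Set.uIoc_of_le hT.le] at hx
      simp [abs_of_pos hx.1]
    have h2 : IntervalIntegrable (fun w : ℝ => |w| ^ p) volume (-T) 0 := by
      rw [IntervalIntegrable.iff_comp_neg]
      simpa using h1.symm
    have := h2.trans h1
    rwa [intervalIntegrable_iff_integrableOn_Ioo_of_le (by linarith)] at this
  have hA : Integrable ((Set.Ioo (-T) T).indicator (fun w : ℝ => |w| ^ p)) volume :=
    h0.integrable_indicator measurableSet_Ioo
  have hB : Integrable ((Set.Ioo 0 T).indicator (fun _ : ℝ => (1:ℝ))) volume :=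
    (integrableOn_const (by simp)).integrable_indicator measurableSet_Ioo
  have hC := hB.convolution_integrand (ContinuousLinearMap.mul ℝ ℝ) hA
  rw [Measure.prod_restrict]
  refine IntegrableOn.congr_fun hC.integrableOn ?_ (measurableSet_Ioo.prod measurableSet_Ioo)
  rintro ⟨u, v⟩ ⟨hu, hv⟩
  simp only [Set.mem_Ioo] at hu hv
  have : u - v ∈ Set.Ioo (-T) T := ⟨by linarith, by linarith⟩
  simp [Set.indicator_of_mem, this, hv]

lemma measurable_phiK (a : ℝ) : Measurable (fun p : ℝ × ℝ => phiK a p.1 p.2) := by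
  unfold phiK
  fun_prop

lemma LHqOp_eq {T H a : ℝ} {q : ℕ} (hq : 1 ≤ q) (hadef : a = 1/2 - (1 - H)/(q:ℝ))
    (ha' : a < 1/2) (f : ℝ → ℝ) {x : Fin q → ℝ}
    (hx : x ∈ Set.univ.pi fun _ : Fin q => Set.Icc (0:ℝ) T) :
    LHqOp T H q f x = cHq H q * ∫ u in Set.Ioo 0 T, f u * ∏ i, phiK a u (x i) := by
  have : Nonempty (Fin q) := ⟨⟨0, hq⟩⟩
  have hx' : ∀ i, x i ∈ Set.Icc (0:ℝ) T := fun i => hx i (Set.mem_univ i)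
  have hbdd : BddAbove (Set.range x) := Set.finite_range x |>.bddAbove
  have hs0 : 0 ≤ ⨆ i, x i := le_ciSup_of_le hbdd ⟨0, hq⟩ (hx' _).1
  have hsT : ⨆ i, x i ≤ T := ciSup_le fun i => (hx' i).2
  unfold LHqOp
  congr 1
  rw [intervalIntegral.integral_of_le hsT, ← integral_Ioc_eq_integral_Ioo]
  have e : ∀ u, f u * ∏ i, (u / x i) ^ (1/2 - (1 - H)/(q:ℝ)) *
      (max (u - x i) 0) ^ (-(1/2 + (1 - H)/(q:ℝ))) = f u * ∏ i, phiK a u (x i) := by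
    intro u
    unfold phiK
    have : -(1/2 + (1 - H)/(q:ℝ)) = a - 1 := by rw [hadef]; ring
    rw [this, hadef]
  simp only [e]
  symm
  refine setIntegral_eq_of_subset_of_forall_sdiff_eq_zero measurableSet_Ioc
    (Set.Ioc_subset_Ioc_left hs0) ?_
  intro u hu
  have hle : u ≤ ⨆ i, x i := by
    by_contra h
    exact hu.2 ⟨not_le.1 h, hu.1.2⟩
  obtain ⟨i, hi⟩ := exists_eq_ciSup_of_finite (f := x)
  rw [← hi] at hle
  rw [Finset.prod_eq_zero (Finset.mem_univ i) (phiK_zero ha' hle), mul_zero]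

lemma diag_ae (T : ℝ) : ∀ᵐ z ∂((volume.restrict (Set.Ioo 0 T)).prod (volume.restrict (Set.Ioo 0 T))),
    z.1 ∈ Set.Ioo 0 T ∧ z.2 ∈ Set.Ioo 0 T ∧ z.1 ≠ z.2 := by
  have h1 : ∀ᵐ z : ℝ × ℝ ∂((volume.restrict (Set.Ioo 0 T)).prod (volume.restrict (Set.Ioo 0 T))),
      z ∈ Set.Ioo 0 T ×ˢ Set.Ioo 0 T := by
    rw [Measure.prod_restrict]
    exact ae_restrict_mem (measurableSet_Ioo.prod measurableSet_Ioo)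
  have h2 : ∀ᵐ z : ℝ × ℝ ∂((volume.restrict (Set.Ioo 0 T)).prod (volume.restrict (Set.Ioo 0 T))),
      z.1 ≠ z.2 := by
    rw [Measure.ae_prod_iff_ae_ae]
    · refine Filter.Eventually.of_forall fun u => ?_
      refine ae_restrict_of_ae ?_
      filter_upwards [Measure.ae_ne volume u] with v hv using hv.symm
    · exact (measurableSet_eq_fun measurable_fst measurable_snd).compl
  filter_upwards [h1, h2] with z hz hz' using ⟨hz.1, hz.2, hz'⟩

lemma core_int {T p B a : ℝ} {q : ℕ} (hT : 0 < T) (ha : 0 < a) (ha' : a < 1/2)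
    (hp : p = q * (2 * a - 1)) (hp1 : -1 < p) (hB : B = betaFn a (1 - 2 * a))
    (f g : ℝ → ℝ) (hf : Measurable f) (hg : Measurable g)
    (hfb : ∃ C, ∀ t ∈ Set.Icc (0:ℝ) T, |f t| ≤ C)
    (hgb : ∃ C, ∀ t ∈ Set.Icc (0:ℝ) T, |g t| ≤ C) :
    ∫ x in Set.univ.pi fun _ : Fin q => Set.Icc (0:ℝ) T,
      (∫ u in Set.Ioo 0 T, f u * ∏ i, phiK a u (x i)) * (∫ v in Set.Ioo 0 T, g v * ∏ i, phiK a v (x i))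
    = B ^ q * ∫ u in Set.Ioo (0:ℝ) T, ∫ v in Set.Ioo (0:ℝ) T, f u * g v * |u - v| ^ p := by
  obtain ⟨Cf, hCf⟩ := hfb
  obtain ⟨Cg, hCg⟩ := hgb
  set I := (volume : Measure ℝ).restrict (Set.Ioo 0 T) with hI
  set X := (volume : Measure (Fin q → ℝ)).restrict (Set.univ.pi fun _ : Fin q => Set.Icc (0:ℝ) T)
    with hX
  have hXpi : X = Measure.pi (fun _ : Fin q => (volume : Measure ℝ).restrict (Set.Icc (0:ℝ) T)) := by
    rw [hX, volume_pi, Measure.restrict_pi_pi]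
  have hsec : ∀ z : ℝ × ℝ, z.1 ∈ Set.Ioo 0 T ∧ z.2 ∈ Set.Ioo 0 T ∧ z.1 ≠ z.2 →
      Integrable (fun x : Fin q → ℝ => ∏ i, (phiK a z.1 (x i) * phiK a z.2 (x i))) X ∧
      ∫ x, ∏ i, (phiK a z.1 (x i) * phiK a z.2 (x i)) ∂X = B ^ q * |z.1 - z.2| ^ p := by
    rintro ⟨u, v⟩ ⟨hu, hv, huv⟩
    obtain ⟨h1, h2⟩ := phi_int ha ha' hu hv huv
    rw [hXpi]
    constructor
    · exact Integrable.fintype_prod (f := fun _ x => phiK a u x * phiK a v x) fun _ => h1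
    · rw [integral_fintype_prod_eq_prod (f := fun _ x => phiK a u x * phiK a v x)]
      simp only [h2, Finset.prod_const, Finset.card_univ, Fintype.card_fin]
      rw [mul_pow, hB, ← Real.rpow_mul_natCast (abs_nonneg _), hp, mul_comm (q:ℝ)]
  have hmeas : Measurable (fun y : (Fin q → ℝ) × (ℝ × ℝ) =>
      (f y.2.1 * g y.2.2) * ∏ i, (phiK a y.2.1 (y.1 i) * phiK a y.2.2 (y.1 i))) := by
    refine Measurable.mul (by fun_prop) ?_
    refine Finset.measurable_prod _ fun i _ => ?_
    refine Measurable.mul ?_ ?_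
    · exact (measurable_phiK a).comp (f := fun y : (Fin q → ℝ) × (ℝ × ℝ) => (y.2.1, y.1 i)) (by fun_prop)
    · exact (measurable_phiK a).comp (f := fun y : (Fin q → ℝ) × (ℝ × ℝ) => (y.2.2, y.1 i)) (by fun_prop)
  have hK := abs_rpow_int hT hp1
  have hfgK : Integrable (fun z : ℝ × ℝ => (f z.1 * g z.2) * |z.1 - z.2| ^ p) (I.prod I) := by
    refine hK.bdd_mul (c := Cf * Cg) (by fun_prop) ?_
    filter_upwards [diag_ae T] with z hz
    rw [norm_mul, Real.norm_eq_abs, Real.norm_eq_abs]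
    have h1 := hCf z.1 (Set.Ioo_subset_Icc_self hz.1)
    have h2 := hCg z.2 (Set.Ioo_subset_Icc_self hz.2.1)
    exact mul_le_mul h1 h2 (abs_nonneg _) ((abs_nonneg _).trans h1)
  have hXnn : ∀ᵐ x ∂X, ∀ i, 0 ≤ x i := by
    filter_upwards [ae_restrict_mem (MeasurableSet.univ_pi fun _ => measurableSet_Icc)] with x hx i
      using (hx i (Set.mem_univ i)).1
  have hint : Integrable (Function.uncurry fun (x : Fin q → ℝ) (z : ℝ × ℝ) =>
      (f z.1 * g z.2) * ∏ i, (phiK a z.1 (x i) * phiK a z.2 (x i))) (X.prod (I.prod I)) := by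
    refine (integrable_prod_iff' hmeas.aestronglyMeasurable).2 ⟨?_, ?_⟩
    · filter_upwards [diag_ae T] with z hz
      exact (hsec z hz).1.const_mul _
    · refine (hfgK.norm.const_mul (B ^ q)).congr ?_
      filter_upwards [diag_ae T] with z hz
      have : ∫ x, ‖f z.1 * g z.2 * ∏ i, (phiK a z.1 (x i) * phiK a z.2 (x i))‖ ∂X
          = ∫ x, ‖f z.1 * g z.2‖ * ∏ i, (phiK a z.1 (x i) * phiK a z.2 (x i)) ∂X := by
        refine integral_congr_ae ?_
        filter_upwards [hXnn] with x hx
        rw [norm_mul]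
        congr 1
        refine Real.norm_of_nonneg (Finset.prod_nonneg fun i _ => ?_)
        exact mul_nonneg (phiK_nonneg hz.1.1.le (hx i)) (phiK_nonneg hz.2.1.1.le (hx i))
      refine Eq.trans ?_ this.symm
      rw [integral_const_mul, (hsec z hz).2, norm_mul, Real.norm_of_nonneg (Real.rpow_nonneg (abs_nonneg _) _)]
      ring
  calc _ = ∫ x, ∫ z, (f z.1 * g z.2) * ∏ i, (phiK a z.1 (x i) * phiK a z.2 (x i)) ∂(I.prod I) ∂X := by
        congr 1
        ext x
        rw [← integral_prod_mul]
        congr 1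
        ext z
        rw [Finset.prod_mul_distrib]
        ring
    _ = ∫ z, ∫ x, (f z.1 * g z.2) * ∏ i, (phiK a z.1 (x i) * phiK a z.2 (x i)) ∂X ∂(I.prod I) :=
        integral_integral_swap hint
    _ = ∫ z, B ^ q * ((f z.1 * g z.2) * |z.1 - z.2| ^ p) ∂(I.prod I) := by
        refine integral_congr_ae ?_
        filter_upwards [diag_ae T] with z hz
        rw [integral_const_mul, (hsec z hz).2]
        ring
    _ = _ := by
        rw [integral_const_mul, integral_prod _ hfgK]

/-- For `T > 0`, `H ∈ (1/2,1)`, `q ≥ 1` and bounded measurable `f, g : [0,T] → ℝ`,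
`q! ∫_{[0,T]^q} (L^{H,q}f)(x) (L^{H,q}g)(x) dx
  = H(2H-1) ∫_0^T ∫_0^T f(u) g(v) |u-v|^{2H-2} du dv`. -/
theorem stmt_5 (T H : ℝ) (hT : 0 < T) (hH : H ∈ Set.Ioo (1/2:ℝ) 1)
    (q : ℕ) (hq : 1 ≤ q) (f g : ℝ → ℝ) (hf : Measurable f) (hg : Measurable g)
    (hfb : ∃ C, ∀ t ∈ Set.Icc (0:ℝ) T, |f t| ≤ C)
    (hgb : ∃ C, ∀ t ∈ Set.Icc (0:ℝ) T, |g t| ≤ C) :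
    (q.factorial : ℝ) *
      (∫ x in Set.univ.pi fun _ : Fin q => Set.Icc (0:ℝ) T, LHqOp T H q f x * LHqOp T H q g x) =
      H * (2*H - 1) *
        (∫ u in Set.Ioo (0:ℝ) T, ∫ v in Set.Ioo (0:ℝ) T, f u * g v * |u - v| ^ (2*H - 2)) := by
  have hq0 : (0:ℝ) < q := by exact_mod_cast hq
  have hq1 : (1:ℝ) ≤ q := by exact_mod_cast hq
  obtain ⟨hH1, hH2⟩ := hH
  obtain ⟨a, hadef⟩ : ∃ a, a = 1/2 - (1 - H)/(q:ℝ) := ⟨_, rfl⟩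
  have hd0 : 0 < (1 - H)/(q:ℝ) := div_pos (by linarith) hq0
  have hd1 : (1 - H)/(q:ℝ) < 1/2 := by
    rw [div_lt_iff₀ hq0]; linarith
  have ha : 0 < a := by linarith
  have ha' : a < 1/2 := by linarith
  have hb : 2 * (1 - H)/(q:ℝ) = 1 - 2 * a := by rw [hadef]; ring
  have hp : 2 * H - 2 = q * (2 * a - 1) := by
    rw [hadef]; field_simp; ring
  have hBpos : 0 < betaFn a (1 - 2 * a) := betaFn_pos ha (by linarith)
  have hfac : (0:ℝ) < q.factorial := by exact_mod_cast q.factorial_pos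
  have hc : cHq H q * cHq H q = H * (2 * H - 1) / ((q.factorial : ℝ) * betaFn a (1 - 2 * a) ^ q) := by
    unfold cHq
    rw [hb, ← hadef, ← Real.sqrt_eq_rpow]
    refine Real.mul_self_sqrt ?_
    have : 0 < 2 * H - 1 := by linarith
    positivity
  have hS : MeasurableSet (Set.univ.pi fun _ : Fin q => Set.Icc (0:ℝ) T) :=
    MeasurableSet.univ_pi fun _ => measurableSet_Icc
  have hLHS : ∫ x in Set.univ.pi fun _ : Fin q => Set.Icc (0:ℝ) T, LHqOp T H q f x * LHqOp T H q g x
      = (cHq H q * cHq H q) * ∫ x in Set.univ.pi fun _ : Fin q => Set.Icc (0:ℝ) T,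
        (∫ u in Set.Ioo 0 T, f u * ∏ i, phiK a u (x i)) *
          (∫ v in Set.Ioo 0 T, g v * ∏ i, phiK a v (x i)) := by
    rw [← integral_const_mul]
    refine setIntegral_congr_fun hS fun x hx => ?_
    simp only [LHqOp_eq hq hadef ha' f hx, LHqOp_eq hq hadef ha' g hx]
    ring
  rw [hLHS, core_int hT ha ha' hp (by linarith) rfl f g hf hg hfb hgb, hc]
  field_simp
end

section
/- Let T > 0, n ∈ ℕ with n ≥ 1, ν ∈ (0,1], and let A, B : [0,T] → ℝ satisfy |A(t) − A(s)| ≤ M|t−s| and |B(t) − B(s)| ≤ L|t−s|^ν for all s, t ∈ [0,T], for some constants M, L ≥ 0. With t_i^n := Ti/n and V_n²(F) := Σ_{i=0}^{n−1} (F(t_{i+1}^n) − F(t_i^n))², one has |V_n²(A + B) − V_n²(B)| ≤ M² T² / n + 2 M L T^{1+ν} / n^ν. -/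
open Real

/-- Deterministic estimate for the quadratic variation along the equidistant partition
`t_i^n = Ti/n` of `[0,T]`: if `A` is `M`-Lipschitz and `B` is `(L,ν)`-Hölder on `[0,T]`,
then `|V_n²(A+B) − V_n²(B)| ≤ M²T²/n + 2MLT^{1+ν}/n^ν`. -/
theorem stmt_16 (T : ℝ) (hT : 0 < T) (n : ℕ) (hn : 1 ≤ n) (ν : ℝ)
    (hν : ν ∈ Set.Ioc (0:ℝ) 1) (A B : ℝ → ℝ) (M L : ℝ) (hM : 0 ≤ M) (hL : 0 ≤ L)
    (hA : ∀ s ∈ Set.Icc (0:ℝ) T, ∀ t ∈ Set.Icc (0:ℝ) T, |A t - A s| ≤ M * |t - s|)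
    (hB : ∀ s ∈ Set.Icc (0:ℝ) T, ∀ t ∈ Set.Icc (0:ℝ) T, |B t - B s| ≤ L * |t - s| ^ ν) :
    |(∑ i ∈ Finset.range n,
        ((A (T * (i + 1) / n) + B (T * (i + 1) / n)) - (A (T * i / n) + B (T * i / n))) ^ 2) -
      (∑ i ∈ Finset.range n, (B (T * (i + 1) / n) - B (T * i / n)) ^ 2)| ≤
      M ^ 2 * T ^ 2 / n + 2 * M * L * T ^ ((1:ℝ) + ν) / (n : ℝ) ^ ν := by
  have hn0 : (0:ℝ) < n := by exact_mod_cast hn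
  have key : ∀ i ∈ Finset.range n,
      |((A (T * (i + 1) / n) + B (T * (i + 1) / n)) - (A (T * i / n) + B (T * i / n))) ^ 2 -
        (B (T * (i + 1) / n) - B (T * i / n)) ^ 2| ≤
      (M * (T / n)) ^ 2 + 2 * (M * (T / n)) * (L * (T / n) ^ ν) := by
    intro i hi
    have hi' : (i:ℝ) + 1 ≤ n := by exact_mod_cast Finset.mem_range.mp hi
    have hi0 : (0:ℝ) ≤ i := Nat.cast_nonneg i
    have h1 : T * (i:ℝ) / n ∈ Set.Icc (0:ℝ) T := by
      refine ⟨by positivity, ?_⟩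
      rw [div_le_iff₀ hn0]
      exact mul_le_mul_of_nonneg_left (by linarith) hT.le
    have h2 : T * ((i:ℝ) + 1) / n ∈ Set.Icc (0:ℝ) T := by
      refine ⟨by positivity, ?_⟩
      rw [div_le_iff₀ hn0]
      exact mul_le_mul_of_nonneg_left hi' hT.le
    have hd : |T * ((i:ℝ) + 1) / n - T * (i:ℝ) / n| = T / n := by
      rw [show T * ((i:ℝ) + 1) / n - T * (i:ℝ) / n = T / n by ring]
      exact abs_of_pos (by positivity)
    have a := hA _ h1 _ h2
    have b := hB _ h1 _ h2
    rw [hd] at a b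
    set x := A (T * ((i:ℝ) + 1) / n) - A (T * (i:ℝ) / n) with hx
    set y := B (T * ((i:ℝ) + 1) / n) - B (T * (i:ℝ) / n) with hy
    have e : ((A (T * (i + 1) / n) + B (T * (i + 1) / n)) - (A (T * i / n) + B (T * i / n))) ^ 2 -
        y ^ 2 = x ^ 2 + 2 * x * y := by rw [hx, hy]; ring
    rw [e]
    calc |x ^ 2 + 2 * x * y| ≤ |x ^ 2| + |2 * x * y| := abs_add_le _ _
      _ = |x| ^ 2 + 2 * |x| * |y| := by rw [abs_mul, abs_mul, abs_pow, abs_two]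
      _ ≤ _ := by gcongr
  rw [← Finset.sum_sub_distrib]
  refine (Finset.abs_sum_le_sum_abs _ _).trans ((Finset.sum_le_sum key).trans (le_of_eq ?_))
  rw [Finset.sum_const, Finset.card_range, nsmul_eq_mul, Real.div_rpow hT.le hn0.le,
    Real.rpow_add hT, Real.rpow_one]
  have : (n:ℝ) ^ ν ≠ 0 := (Real.rpow_pos_of_pos hn0 ν).ne'
  field_simp
end
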